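/- Let k ≥ 4 and let σ, τ ∈ S_k be permutations satisfying: σ_1 = τ_1 = 1; σ_2 = k and τ_2 = k−1; σ_{k−1} = τ_{k−1} = k−2; σ_k = k−1 and τ_k = k; and the middle entries σ_3,…,σ_{k−2} and τ_3,…,τ_{k−2} are each an arbitrary arrangement of the set {2,3,…,k−3} (for k = 4 there are no middle entries, so σ = 1423 and τ = 1324). Then μ(T_σ < T_τ) = 1/2. -/

import Mathlib

open MeasureTheory ProbabilityTheory Real

noncomputable section

/-- The window of `x` of length `k` starting at position `i` (0-indexed) is a consecutive
occurrence of the pattern `σ`, i.e., its standardization is `σ` (relative orders agree). -/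
def OccursAt {k : ℕ} (σ : Equiv.Perm (Fin k)) (x : ℕ → ℝ) (i : ℕ) : Prop :=
  ∀ a b : Fin k, x (i + a) < x (i + b) ↔ σ a < σ b

/-- `hitTime σ x` is the number of draws until the first consecutive occurrence of `σ`,
i.e., the least `j ≥ k` such that the window `x_{j-k}, …, x_{j-1}` is an occurrence of `σ`. -/
def hitTime {k : ℕ} (σ : Equiv.Perm (Fin k)) (x : ℕ → ℝ) : ℕ :=
  sInf {j | k ≤ j ∧ OccursAt σ x (j - k)}

/-- `μ` is the law of an i.i.d. sequence of uniform random variables on `[0,1]`: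
a probability measure on `ℕ → ℝ` whose finite-dimensional marginals are products of
the uniform measure on `[0,1]`. -/
def IsIIDUniform (μ : Measure (ℕ → ℝ)) : Prop :=
  IsProbabilityMeasure μ ∧
  ∀ n : ℕ, μ.map (fun x (i : Fin n) => x i) =
    Measure.pi (fun _ : Fin n => (volume : Measure ℝ).restrict (Set.Icc 0 1))

/-- The pattern `σ ∈ S_k` occurs consecutively at position `i` (0-indexed) in the
permutation `p ∈ S_n`, written in one-line notation. -/
def PermOccursAt {k n : ℕ} (σ : Equiv.Perm (Fin k)) (p : Equiv.Perm (Fin n)) (i : ℕ) : Prop :=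
  ∃ h : i + k ≤ n, ∀ a b : Fin k,
    p ⟨i + a, Nat.lt_of_lt_of_le (Nat.add_lt_add_left a.isLt i) h⟩ <
      p ⟨i + b, Nat.lt_of_lt_of_le (Nat.add_lt_add_left b.isLt i) h⟩ ↔ σ a < σ b

/-- `avoidCount σ n` is the number `α_n(σ)` of permutations in `S_n` avoiding `σ`
as a consecutive pattern. -/
def avoidCount {k : ℕ} (σ : Equiv.Perm (Fin k)) (n : ℕ) : ℕ :=
  Nat.card {p : Equiv.Perm (Fin n) // ∀ i, ¬ PermOccursAt σ p i}

/-- Neither of the patterns `σ`, `τ` contains a consecutive occurrence of the other. -/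
def Incomparable {k l : ℕ} (σ : Equiv.Perm (Fin k)) (τ : Equiv.Perm (Fin l)) : Prop :=
  (∀ i, ¬ PermOccursAt σ τ i) ∧ (∀ i, ¬ PermOccursAt τ σ i)

abbrev unifM : Measure ℝ := (volume : Measure ℝ).restrict (Set.Icc 0 1)

instance unifM_prob : IsProbabilityMeasure unifM := ⟨by simp [unifM]⟩

lemma iid_box {μ : Measure (ℕ → ℝ)} (hμ : IsIIDUniform μ) (s : Finset ℕ) (t : ℕ → Set ℝ)
    (ht : ∀ i, MeasurableSet (t i)) : μ (Set.pi s t) = ∏ i ∈ s, unifM (t i) := by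
  classical
  obtain ⟨N, hN⟩ : ∃ N, s ⊆ Finset.range N := ⟨s.sup id + 1, fun i hi => by
    have : i ≤ s.sup id := Finset.le_sup (f := id) hi
    simp; omega⟩
  let t' : ℕ → Set ℝ := fun i => if i ∈ s then t i else Set.univ
  have ht' : ∀ i, MeasurableSet (t' i) := fun i => by
    by_cases h : i ∈ s <;> simp [t', h, ht]
  have h1 : (Set.pi s t : Set (ℕ → ℝ)) =
      (fun x (i : Fin N) => x i) ⁻¹' (Set.univ.pi fun i : Fin N => t' i) := by
    ext x
    simp only [Set.mem_pi, Set.mem_preimage, Finset.mem_coe, Set.mem_univ, true_imp_iff]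
    constructor
    · intro h i
      by_cases hi : (i : ℕ) ∈ s
      · simpa [t', hi] using h i hi
      · simp [t', hi]
    · intro h i hi
      have := h ⟨i, by simpa using hN hi⟩
      simpa [t', hi] using this
  rw [h1, ← Measure.map_apply (by fun_prop) (MeasurableSet.univ_pi fun i : Fin N => ht' i), hμ.2 N,
    Measure.pi_pi]
  change ∏ i : Fin N, unifM (t' i) = _
  rw [Fin.prod_univ_eq_prod_range (fun i => unifM (t' i)) N]
  rw [← Finset.prod_subset hN]
  · exact Finset.prod_congr rfl fun i hi => by simp [t', hi]
  · intro i _ hi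
    simp only [t', hi, if_false]
    exact measure_univ

lemma iid_eq {μ : Measure (ℕ → ℝ)} (hμ : IsIIDUniform μ) :
    μ = Measure.infinitePi (fun _ : ℕ => unifM) :=
  Measure.eq_infinitePi _ fun s t ht => iid_box hμ s t ht

lemma iid_perm {μ : Measure (ℕ → ℝ)} (hμ : IsIIDUniform μ) (g : Equiv.Perm ℕ) :
    MeasurePreserving (fun x : ℕ → ℝ => x ∘ g) μ μ := by
  refine ⟨by fun_prop, ?_⟩
  conv_rhs => rw [iid_eq hμ]
  refine Measure.eq_infinitePi _ fun s t ht => ?_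
  rw [Measure.map_apply (by fun_prop) (MeasurableSet.pi s.countable_toSet fun i _ => ht i)]
  have : (fun x : ℕ → ℝ => x ∘ g) ⁻¹' (Set.pi s t) =
      Set.pi (s.map g.toEmbedding : Finset ℕ) (fun i => t (g.symm i)) := by
    ext x
    simp only [Set.mem_preimage, Set.mem_pi, Finset.mem_coe, Finset.mem_map_equiv,
      Function.comp_apply]
    constructor
    · intro h i hi
      simpa using h _ hi
    · intro h i hi
      simpa using h (g i) (by simpa using hi)
  rw [this, iid_box hμ _ _ (fun i => ht _)]
  simp

lemma iid_inj {μ : Measure (ℕ → ℝ)} (hμ : IsIIDUniform μ) :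
    ∀ᵐ x ∂μ, Function.Injective x := by
  have h : ∀ i j : ℕ, i ≠ j → ∀ᵐ x ∂μ, x i ≠ x j := by
    intro i j hij
    have hp := hμ.1
    have hm : μ.map (fun x : ℕ → ℝ => (x i, x j)) = unifM.prod unifM := by
      rw [iid_eq hμ]
      exact Measure.infinitePi_map_eval_prod (P := fun _ : ℕ => unifM) hij
    have hD : MeasurableSet {p : ℝ × ℝ | p.1 = p.2} :=
      measurableSet_eq_fun measurable_fst measurable_snd
    have h0 : (unifM.prod unifM) {p : ℝ × ℝ | p.1 = p.2} = 0 := by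
      rw [Measure.measure_prod_null hD]
      refine Filter.Eventually.of_forall fun a => ?_
      have : (Prod.mk a ⁻¹' {p : ℝ × ℝ | p.1 = p.2}) = {a} := by
        ext b; simp [eq_comm]
      change unifM (Prod.mk a ⁻¹' {p : ℝ × ℝ | p.1 = p.2}) = 0
      rw [this]; simp
    rw [← hm, Measure.map_apply (by fun_prop) hD] at h0
    rw [ae_iff]
    simpa using h0
  have h2 : ∀ᵐ x ∂μ, ∀ i j : ℕ, i ≠ j → x i ≠ x j := by
    rw [ae_all_iff]; intro i
    rw [ae_all_iff]; intro j
    by_cases hij : i = j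
    · simp [hij]
    · filter_upwards [h i j hij] with x hx _ using hx
  filter_upwards [h2] with x hx i j hij
  by_contra hne
  exact hx i j hne hij

lemma occurs_ae {μ : Measure (ℕ → ℝ)} (hμ : IsIIDUniform μ) {k : ℕ} (hk : 0 < k)
    (σ : Equiv.Perm (Fin k)) : ∀ᵐ x ∂μ, ∃ i, OccursAt σ x i := by
  classical
  have hp := hμ.1
  have hk' : (0 : ℝ) < k := by exact_mod_cast hk
  let c : ℕ → ℕ := fun m => (σ ⟨m % k, Nat.mod_lt _ hk⟩ : ℕ)
  let t : ℕ → Set ℝ := fun m => Set.Ioo ((c m : ℝ) / k) (((c m : ℝ) + 1) / k)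
  have ht : ∀ m, MeasurableSet (t m) := fun m => measurableSet_Ioo
  have hc : ∀ m, c m < k := fun m => Fin.isLt _
  have htm : ∀ m, unifM (t m) = ENNReal.ofReal (1 / k) := by
    intro m
    have hsub : t m ⊆ Set.Icc 0 1 := by
      intro y hy
      have h1 : (c m : ℝ) + 1 ≤ k := by exact_mod_cast hc m
      refine ⟨le_trans (by positivity) hy.1.le, hy.2.le.trans ?_⟩
      rw [div_le_one hk']; exact h1
    rw [unifM, Measure.restrict_apply (ht m), Set.inter_eq_left.2 hsub, Real.volume_Ioo]
    congr 1
    field_simp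
    ring
  let S : ℕ → Finset ℕ := fun n => Finset.Ico (n * k) (n * k + k)
  let B : ℕ → Set (ℕ → ℝ) := fun n => Set.pi (S n) t
  have hBm : ∀ n, MeasurableSet (B n) := fun n =>
    MeasurableSet.pi (S n).countable_toSet fun i _ => ht i
  have hBμ : ∀ n, μ (B n) = ENNReal.ofReal (1 / k) ^ k := by
    intro n
    simp only [B]
    rw [iid_box hμ _ _ ht]
    simp [htm, S]
  have hdisj : ∀ F : Finset ℕ, Set.PairwiseDisjoint (F : Set ℕ) S := by
    intro F a _ b _ hab
    rw [Function.onFun, Finset.disjoint_left]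
    intro m hma hmb
    simp only [S, Finset.mem_Ico] at hma hmb
    rcases lt_or_gt_of_ne hab with h | h
    · have := Nat.mul_le_mul_right k (show a + 1 ≤ b from h)
      rw [Nat.add_mul] at this; omega
    · have := Nat.mul_le_mul_right k (show b + 1 ≤ a from h)
      rw [Nat.add_mul] at this; omega
  have hind : iIndepSet B μ := by
    rw [iIndepSet_iff_meas_biInter hBm]
    intro F
    have : (⋂ i ∈ F, B i) = Set.pi (F.biUnion S : Finset ℕ) t := by
      ext x
      simp only [B, Set.mem_iInter, Set.mem_pi, Finset.mem_coe, Finset.mem_biUnion]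
      constructor
      · rintro h i ⟨a, ha, hi⟩
        exact h a ha i hi
      · intro h a ha i hi
        exact h i ⟨a, ha, hi⟩
    rw [this, iid_box hμ _ _ ht, Finset.prod_biUnion (hdisj F)]
    exact Finset.prod_congr rfl fun a _ => (iid_box hμ _ _ ht).symm
  have hsum : ∑' n, μ (B n) = ⊤ := by
    simp only [hBμ]
    refine ENNReal.tsum_const_eq_top_of_ne_zero ?_
    refine pow_ne_zero _ ?_
    simp [hk]
  have hl := measure_limsup_eq_one hBm hind hsum
  have hae : ∀ᵐ x ∂μ, x ∈ Filter.limsup B Filter.atTop := by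
    change Filter.limsup B Filter.atTop ∈ ae μ
    rw [mem_ae_iff, prob_compl_eq_zero_iff]
    · exact hl
    · exact MeasurableSet.measurableSet_limsup hBm
  filter_upwards [hae] with x hx
  rw [Filter.mem_limsup_iff_frequently_mem] at hx
  obtain ⟨n, hn⟩ := hx.exists
  refine ⟨n * k, ?_⟩
  have hx' : ∀ a : Fin k, x (n * k + a) ∈ Set.Ioo (((σ a : ℕ) : ℝ) / k) ((((σ a : ℕ) : ℝ) + 1) / k) := by
    intro a
    have h1 := hn (n * k + a) (by simp [S])
    have h2 : c (n * k + a) = (σ a : ℕ) := by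
      simp only [c]
      congr 3
      rw [Nat.mul_comm, Nat.mul_add_mod, Nat.mod_eq_of_lt a.isLt]
    simp only [t, h2] at h1
    exact h1
  have key : ∀ a b : Fin k, σ a < σ b → x (n * k + a) < x (n * k + b) := by
    intro a b hab
    refine (hx' a).2.trans_le (le_trans ?_ (hx' b).1.le)
    have : ((σ a : ℕ) : ℝ) + 1 ≤ (σ b : ℕ) := by exact_mod_cast hab
    gcongr
  intro a b
  refine ⟨fun h => ?_, key a b⟩
  by_contra hne
  rcases lt_or_eq_of_le (not_lt.1 hne) with h' | h'
  · exact absurd (key b a h') (not_lt.2 h.le)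
  · rw [σ.injective h'] at h; exact lt_irrefl _ h

/-- The window at `i` has its least entry first, its third largest entry at the penultimate place,
and its two largest entries at the second and last places. -/
def HWin (k : ℕ) (x : ℕ → ℝ) (i : ℕ) : Prop :=
  x i < x (i + (k - 2)) ∧ x (i + (k - 2)) < x (i + 1) ∧ x (i + (k - 2)) < x (i + (k - 1)) ∧
  ∀ c, 2 ≤ c → c + 3 ≤ k → x i < x (i + c) ∧ x (i + c) < x (i + (k - 2))

lemma HWin.overlap {k : ℕ} (hk : 4 ≤ k) {x : ℕ → ℝ} {u v : ℕ} (hu : HWin k x u)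
    (hv : HWin k x v) (huv : u < v) : u + (k - 2) ≤ v := by
  by_contra hlt
  obtain ⟨d, rfl⟩ := Nat.exists_eq_add_of_lt huv
  obtain ⟨u1, u2, u3, u4⟩ := hu
  obtain ⟨v1, v2, v3, v4⟩ := hv
  -- lower comparison in first window
  have hu5 : ∀ c, 2 ≤ c → c + 2 ≤ k → x (u + c) < x (u + 1) ∧ x (u + c) < x (u + (k - 1)) := by
    intro c h1 h2
    rcases Nat.lt_or_ge (c + 2) k with h | h
    · have := u4 c h1 (by omega)
      constructor <;> linarith
    · have : c = k - 2 := by omega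
      subst this
      exact ⟨u2, u3⟩
  have hv5 : ∀ c, 1 ≤ c → c + 1 ≤ k → x (u + d + 1) < x (u + d + 1 + c) := by
    intro c h1 h2
    by_cases h : c = 1
    · subst h; linarith
    by_cases h : c + 3 ≤ k
    · exact (v4 c (by omega) h).1
    by_cases h : c = k - 2
    · subst h; exact v1
    have : c = k - 1 := by omega
    subst this; linarith
  rcases Nat.eq_zero_or_pos d with hd | hd
  · subst hd
    have h1 := (hu5 2 le_rfl hk).1
    have h2 := hv5 1 le_rfl (by omega)
    simp only [Nat.add_zero, Nat.add_assoc] at h1 h2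
    norm_num at h1 h2
    linarith
  · have h1 := (hu5 (d + 2) (by omega) (by omega)).2
    have h2 := (v4 (k - 2 - d) (by omega) (by omega)).2
    have e1 : u + d + 1 + (k - 2 - d) = u + (k - 1) := by omega
    have e2 : u + d + 1 + 1 = u + (d + 2) := by omega
    rw [e1] at h2
    rw [e2] at v2
    linarith

/-- Shape of a pattern. -/
structure Shape {k : ℕ} (σ : Equiv.Perm (Fin k)) : Prop where
  hk : 4 ≤ k
  s0 : ∀ a : Fin k, (a : ℕ) = 0 → (σ a : ℕ) = 0
  s2 : ∀ a : Fin k, (a : ℕ) = k - 2 → (σ a : ℕ) = k - 3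
  s1 : ∀ a : Fin k, (a : ℕ) = 1 → k - 2 ≤ (σ a : ℕ)
  s3 : ∀ a : Fin k, (a : ℕ) = k - 1 → k - 2 ≤ (σ a : ℕ)

lemma Shape.mid {k : ℕ} {σ : Equiv.Perm (Fin k)} (h : Shape σ) (a : Fin k) (h1 : 2 ≤ (a : ℕ))
    (h2 : (a : ℕ) + 3 ≤ k) : 1 ≤ (σ a : ℕ) ∧ (σ a : ℕ) + 4 ≤ k := by
  have hk := h.hk
  have e0 := h.s0 ⟨0, by omega⟩ rfl
  have e1 := h.s1 ⟨1, by omega⟩ rfl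
  have e2 := h.s2 ⟨k - 2, by omega⟩ rfl
  have e3 := h.s3 ⟨k - 1, by omega⟩ rfl
  have ne : ∀ a b : Fin k, (a : ℕ) ≠ b → (σ a : ℕ) ≠ σ b := by
    intro a b hab he
    exact hab (by rw [σ.injective (Fin.ext he)])
  have n0 := ne a ⟨0, by omega⟩ (by simp; omega)
  have n1 := ne a ⟨1, by omega⟩ (by simp; omega)
  have n2 := ne a ⟨k - 2, by omega⟩ (by simp; omega)
  have n3 := ne a ⟨k - 1, by omega⟩ (by simp; omega)
  have n4 := ne ⟨1, by omega⟩ ⟨k - 1, by omega⟩ (by simp; omega)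
  have b0 := (σ a).isLt
  have b1 := (σ ⟨1, by omega⟩).isLt
  have b2 := (σ ⟨k - 1, by omega⟩).isLt
  omega

lemma Shape.mid_inv {k : ℕ} {σ : Equiv.Perm (Fin k)} (h : Shape σ) (a : Fin k)
    (h1 : 1 ≤ (σ a : ℕ)) (h2 : (σ a : ℕ) + 4 ≤ k) : 2 ≤ (a : ℕ) ∧ (a : ℕ) + 3 ≤ k := by
  have hk := h.hk
  have e0 := h.s0 a
  have e1 := h.s1 a
  have e2 := h.s2 a
  have e3 := h.s3 a
  have := a.isLt
  omega

lemma occ_iff {k : ℕ} {σ : Equiv.Perm (Fin k)} (h : Shape σ) {x : ℕ → ℝ}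
    (hx : Function.Injective x) (i : ℕ) (f l : Fin k) (hf : (f : ℕ) = 1) (hl : (l : ℕ) = k - 1) :
    OccursAt σ x i ↔ HWin k x i ∧
      (∀ a b : Fin k, 2 ≤ (a : ℕ) → (a : ℕ) + 3 ≤ k → 2 ≤ (b : ℕ) → (b : ℕ) + 3 ≤ k →
        (x (i + a) < x (i + b) ↔ σ a < σ b)) ∧
      (x (i + 1) < x (i + (k - 1)) ↔ σ f < σ l) := by
  have hk := h.hk
  constructor
  · intro ho
    have ho' : ∀ a b : Fin k, (σ a : ℕ) < σ b → x (i + a) < x (i + b) := fun a b hab =>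
      (ho a b).2 hab
    have e0 := h.s0 ⟨0, by omega⟩ rfl
    have e1 := h.s1 f hf
    have e2 := h.s2 ⟨k - 2, by omega⟩ rfl
    have e3 := h.s3 l hl
    refine ⟨⟨?_, ?_, ?_, ?_⟩, fun a b _ _ _ _ => ho a b, ?_⟩
    · exact ho' ⟨0, by omega⟩ ⟨k - 2, by omega⟩ (by omega)
    · have := ho' ⟨k - 2, by omega⟩ f (by omega)
      simpa [hf] using this
    · have := ho' ⟨k - 2, by omega⟩ l (by omega)
      simpa [hl] using this
    · intro c h1 h2
      have e4 := h.mid ⟨c, by omega⟩ h1 h2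
      exact ⟨ho' ⟨0, by omega⟩ ⟨c, by omega⟩ (by omega),
        ho' ⟨c, by omega⟩ ⟨k - 2, by omega⟩ (by omega)⟩
    · have := ho f l
      rwa [hf, hl] at this
  · rintro ⟨⟨w1, w2, w3, w4⟩, hm, hs⟩
    have cls : ∀ a : Fin k, ((a : ℕ) = 0 ∨ a = f ∨ (2 ≤ (a : ℕ) ∧ (a : ℕ) + 3 ≤ k) ∨
        (a : ℕ) = k - 2 ∨ a = l) := by
      intro a
      have := a.isLt
      simp only [Fin.ext_iff]
      omega
    have e1 := h.s1 f hf
    have e3 := h.s3 l hl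
    have key : ∀ a b : Fin k, σ a < σ b → x (i + a) < x (i + b) := by
      intro a b hab
      have hab' : (σ a : ℕ) < σ b := hab
      rcases cls a with ha | rfl | ⟨ha1, ha2⟩ | ha | rfl
      · have ea := h.s0 a ha
        rcases cls b with hb | rfl | ⟨hb1, hb2⟩ | hb | rfl
        · have := h.s0 b hb; omega
        · rw [ha, hf, Nat.add_zero]; linarith
        · rw [ha, Nat.add_zero]; exact (w4 b hb1 hb2).1
        · rw [ha, hb, Nat.add_zero]; linarith
        · rw [ha, hl, Nat.add_zero]; linarith
      · rcases cls b with hb | rfl | ⟨hb1, hb2⟩ | hb | rfl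
        · have := h.s0 b hb; omega
        · omega
        · have := h.mid b hb1 hb2; omega
        · have := h.s2 b hb; omega
        · rw [hf, hl]; exact hs.2 hab
      · have ea := h.mid a ha1 ha2
        have wa := w4 a ha1 ha2
        rcases cls b with hb | rfl | ⟨hb1, hb2⟩ | hb | rfl
        · have := h.s0 b hb; omega
        · rw [hf]; linarith
        · exact (hm a b ha1 ha2 hb1 hb2).2 hab
        · rw [hb]; linarith
        · rw [hl]; linarith
      · have ea := h.s2 a ha
        rcases cls b with hb | rfl | ⟨hb1, hb2⟩ | hb | rfl
        · have := h.s0 b hb; omega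
        · rw [ha, hf]; exact w2
        · have := h.mid b hb1 hb2; omega
        · have := h.s2 b hb; omega
        · rw [ha, hl]; exact w3
      · rcases cls b with hb | rfl | ⟨hb1, hb2⟩ | hb | rfl
        · have := h.s0 b hb; omega
        · rw [hf, hl]
          have hn : ¬ x (i + 1) < x (i + (k - 1)) := fun h' => absurd (hs.1 h') (not_lt.2 hab.le)
          refine lt_of_le_of_ne (not_lt.1 hn) fun he => ?_
          have := hx he
          omega
        · have := h.mid b hb1 hb2; omega
        · have := h.s2 b hb; omega
        · omega
    intro a b
    refine ⟨fun h => ?_, key a b⟩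
    by_contra hne
    rcases lt_or_eq_of_le (not_lt.1 hne) with h' | h'
    · exact absurd (key b a h') (not_lt.2 h.le)
    · rw [σ.injective h'] at h; exact lt_irrefl _ h

/-- First occurrence of `σ` or `τ` is an occurrence of `σ` at position `i`. -/
def FirstAt {k : ℕ} (σ τ : Equiv.Perm (Fin k)) (i : ℕ) (x : ℕ → ℝ) : Prop :=
  Function.Injective x ∧ OccursAt σ x i ∧ ∀ j < i, ¬ OccursAt σ x j ∧ ¬ OccursAt τ x j

/-- The window overlapping by two entries has the general shape and changes sign. -/
def RCond (k i : ℕ) (x : ℕ → ℝ) : Prop :=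
  ∃ j, j + (k - 2) = i ∧ HWin k x j ∧ (x (j + 1) < x (i + 1) ↔ ¬ x (j + 1) < x (i + (k - 1)))

/-- A pair of patterns of opposite signs. -/
structure Pat {k : ℕ} (σ τ : Equiv.Perm (Fin k)) : Prop where
  hs : Shape σ
  ht : Shape τ
  opp1 : ∀ f l : Fin k, (f : ℕ) = 1 → (l : ℕ) = k - 1 → σ f = τ l
  opp2 : ∀ f l : Fin k, (f : ℕ) = 1 → (l : ℕ) = k - 1 → σ l = τ f

lemma Pat.symm {k : ℕ} {σ τ : Equiv.Perm (Fin k)} (h : Pat σ τ) : Pat τ σ :=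
  ⟨h.ht, h.hs, fun f l hf hl => (h.opp2 f l hf hl).symm, fun f l hf hl => (h.opp1 f l hf hl).symm⟩

lemma Pat.sign {k : ℕ} {σ τ : Equiv.Perm (Fin k)} (h : Pat σ τ) (f l : Fin k) (hf : (f : ℕ) = 1)
    (hl : (l : ℕ) = k - 1) : τ f < τ l ↔ ¬ σ f < σ l := by
  have hk := h.hs.hk
  rw [h.opp1 f l hf hl, h.opp2 f l hf hl, not_lt]
  refine ⟨le_of_lt, fun h' => lt_of_le_of_ne h' fun he => ?_⟩
  have := τ.injective he
  rw [Fin.ext_iff] at this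
  omega

lemma occ_congr {k : ℕ} {σ : Equiv.Perm (Fin k)} {x y : ℕ → ℝ} {j : ℕ}
    (h : ∀ a : Fin k, y (j + a) = x (j + a)) (ho : OccursAt σ y j) : OccursAt σ x j := by
  intro a b
  rw [← h a, ← h b]
  exact ho a b

lemma step1 {k : ℕ} {σ τ : Equiv.Perm (Fin k)} (hp : Pat σ τ) {x y : ℕ → ℝ} {i : ℕ}
    (hA : FirstAt σ τ i x) (hR : ¬ RCond k i x) (hy : Function.Injective y)
    (hlow : ∀ n ≤ i, y n = x n) (h1 : y (i + 1) = x (i + (k - 1)))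
    (h2 : y (i + (k - 1)) = x (i + 1)) (ho : OccursAt τ y i) :
    FirstAt τ σ i y ∧ ¬ RCond k i y := by
  have hk := hp.hs.hk
  obtain ⟨hx, hxo, hxn⟩ := hA
  let f : Fin k := ⟨1, by omega⟩
  let l : Fin k := ⟨k - 1, by omega⟩
  have hHx := ((occ_iff hp.hs hx i f l rfl rfl).1 hxo).1
  have hHy := ((occ_iff hp.ht hy i f l rfl rfl).1 ho).1
  have low : ∀ j, j + (k - 2) = i → ∀ c, c + 2 ≤ k → y (j + c) = x (j + c) := by
    intro j hj c hc
    exact hlow _ (by omega)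
  have last : ∀ j, j + (k - 2) = i → j + (k - 1) = i + 1 := by intro j hj; omega
  have hH : ∀ j, j + (k - 2) = i → HWin k y j → HWin k x j := by
    intro j hj hw
    obtain ⟨w1, w2, w3, w4⟩ := hw
    rw [low j hj _ (by omega), low j hj _ (by omega)] at w2
    rw [low j hj _ (by omega), hlow j (by omega)] at w1
    refine ⟨w1, w2, ?_, ?_⟩
    · rw [last j hj, hj]
      exact hHx.2.1.trans' hHx.1 
    · intro c hc1 hc2
      have := w4 c hc1 hc2
      rwa [low j hj _ (by omega), low j hj _ (by omega), hlow j (by omega)] at this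
  have main : ∀ ρ : Equiv.Perm (Fin k), Shape ρ → (∀ j < i, ¬ OccursAt ρ x j) →
      ∀ j < i, ¬ OccursAt ρ y j := by
    intro ρ hρ hn j hj hoy
    have hc := (occ_iff hρ hy j f l rfl rfl).1 hoy
    have hov := hc.1.overlap hk hHy hj
    refine hn j hj ?_
    rcases hov.lt_or_eq with hlt | heq
    · refine occ_congr (fun a => hlow _ ?_) hoy
      have := a.isLt
      omega
    · refine (occ_iff hρ hx j f l rfl rfl).2 ⟨hH j heq hc.1, ?_, ?_⟩
      · intro a b ha1 ha2 hb1 hb2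
        rw [← hc.2.1 a b ha1 ha2 hb1 hb2, low j heq _ (by omega), low j heq _ (by omega)]
      · rw [← hc.2.2, last j heq, h1, hlow (j + 1) (by omega)]
        by_contra hcon
        exact hR ⟨j, heq, hH j heq hc.1, by tauto⟩
  refine ⟨⟨hy, ho, fun j hj => ⟨main τ hp.ht (fun j hj => (hxn j hj).2) j hj,
    main σ hp.hs (fun j hj => (hxn j hj).1) j hj⟩⟩, ?_⟩
  rintro ⟨j, hj, hw, hb⟩
  refine hR ⟨j, hj, hH j hj hw, ?_⟩
  rw [h1, h2, hlow (j + 1) (by omega)] at hb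
  tauto

lemma step2 {k : ℕ} {σ τ p : Equiv.Perm (Fin k)} (hp : Pat σ τ) (hpp : ∀ a, σ (p a) = τ a)
    {x y : ℕ → ℝ} {i j : ℕ} (hj : j + (k - 2) = i)
    (hA : FirstAt σ τ i x) (hw : HWin k x j)
    (hb : x (j + 1) < x (i + 1) ↔ ¬ x (j + 1) < x (i + (k - 1))) (hy : Function.Injective y)
    (hlow : ∀ n ≤ j + 1, y n = x n)
    (hmid : ∀ a : Fin k, 2 ≤ (a : ℕ) → (a : ℕ) + 3 ≤ k → y (j + p a) = x (j + a))
    (h0 : y i = x i) (h1 : y (i + 1) = x (i + (k - 1)))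
    (h2 : y (i + (k - 1)) = x (i + 1)) (ho : OccursAt τ y i) :
    FirstAt τ σ i y ∧ RCond k i y := by
  have hk := hp.hs.hk
  obtain ⟨hx, hxo, hxn⟩ := hA
  let f : Fin k := ⟨1, by omega⟩
  let l : Fin k := ⟨k - 1, by omega⟩
  have hcx := (occ_iff hp.hs hx i f l rfl rfl).1 hxo
  have hHx := hcx.1
  have hHy := ((occ_iff hp.ht hy i f l rfl rfl).1 ho).1
  have last : j + (k - 1) = i + 1 := by omega
  have hpm : ∀ a : Fin k, 2 ≤ (a : ℕ) → (a : ℕ) + 3 ≤ k → 2 ≤ (p a : ℕ) ∧ (p a : ℕ) + 3 ≤ k := by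
    intro a ha1 ha2
    have := hp.ht.mid a ha1 ha2
    rw [← hpp] at this
    exact hp.hs.mid_inv _ this.1 this.2
  have hpm' : ∀ a : Fin k, 2 ≤ (a : ℕ) → (a : ℕ) + 3 ≤ k →
      ∃ b : Fin k, 2 ≤ (b : ℕ) ∧ (b : ℕ) + 3 ≤ k ∧ p b = a := by
    intro a ha1 ha2
    have := hp.hs.mid a ha1 ha2
    rw [← p.apply_symm_apply a, hpp] at this
    have h3 := hp.ht.mid_inv _ this.1 this.2
    exact ⟨p.symm a, h3.1, h3.2, p.apply_symm_apply a⟩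
  have hHyj : HWin k y j := by
    obtain ⟨w1, w2, w3, w4⟩ := hw
    refine ⟨?_, ?_, ?_, ?_⟩
    · rw [hj, h0, hlow j (by omega), ← hj]; exact w1
    · rw [hj, h0, hlow (j + 1) (by omega), ← hj]; exact w2
    · rw [hj, last]
      exact hHy.2.1.trans' hHy.1
    · intro c hc1 hc2
      obtain ⟨b, hb1, hb2, hb3⟩ := hpm' ⟨c, by omega⟩ hc1 hc2
      have := hmid b hb1 hb2
      rw [hb3] at this
      simp only at this
      rw [this, hj, h0, hlow j (by omega), ← hj]
      exact w4 b hb1 hb2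
  have hsg := hp.sign f l rfl rfl
  have main : ∀ ρ : Equiv.Perm (Fin k), ρ = σ ∨ ρ = τ → ∀ u < i, ¬ OccursAt ρ y u := by
    intro ρ hρ u hu hoy
    have hρs : Shape ρ := by rcases hρ with rfl | rfl; exacts [hp.hs, hp.ht]
    have hc := (occ_iff hρs hy u f l rfl rfl).1 hoy
    have hov := hc.1.overlap hk hHy hu
    rcases hov.lt_or_eq with hlt | heq
    · have hov2 := hc.1.overlap hk hHyj (by omega)
      have hox : OccursAt ρ x u := by
        refine occ_congr (fun a => hlow _ ?_) hoy
        have := a.isLt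
        omega
      rcases hρ with rfl | rfl
      · exact (hxn u hu).1 hox
      · exact (hxn u hu).2 hox
    · obtain rfl : u = j := by omega
      have hsy := hc.2.2
      rw [last, h1, hlow (u + 1) (by omega)] at hsy
      rcases hρ with rfl | rfl
      · refine (hxn u hu).2 ((occ_iff hp.ht hx u f l rfl rfl).2 ⟨hw, ?_, ?_⟩)
        · intro a b ha1 ha2 hb1 hb2
          rw [← hmid a ha1 ha2, ← hmid b hb1 hb2, ← hpp a, ← hpp b]
          exact hc.2.1 _ _ (hpm a ha1 ha2).1 (hpm a ha1 ha2).2 (hpm b hb1 hb2).1 (hpm b hb1 hb2).2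
        · rw [last]; tauto
      · have hsx := hcx.2.2
        by_cases hq : x (i + 1) < x (i + (k - 1))
        · have h3 : ¬ x (u + 1) < x (i + (k - 1)) := by tauto
          have h4 : x (u + 1) < x (i + 1) := by tauto
          exact h3 (h4.trans hq)
        · have h3 : x (u + 1) < x (i + (k - 1)) := by tauto
          have h4 : ¬ x (u + 1) < x (i + 1) := by tauto
          exact h4 (h3.trans_le (not_lt.1 hq))
  refine ⟨⟨hy, ho, fun u hu => ⟨main τ (Or.inr rfl) u hu, main σ (Or.inl rfl) u hu⟩⟩,
    j, hj, hHyj, ?_⟩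
  rw [h1, h2, hlow (j + 1) (by omega)]
  tauto

/-- The embedding of a window. -/
def winEmb (k i : ℕ) : Fin k ↪ ℕ := ⟨fun a => i + a, fun _ _ h => Fin.ext (Nat.add_left_cancel h)⟩

/-- A permutation of the window at `i`, extended to `ℕ`. -/
def winPerm {k : ℕ} (i : ℕ) (p : Equiv.Perm (Fin k)) : Equiv.Perm ℕ := p.viaEmbedding (winEmb k i)

lemma winPerm_apply {k : ℕ} (i : ℕ) (p : Equiv.Perm (Fin k)) (a : Fin k) :
    winPerm i p (i + a) = i + p a :=
  p.viaEmbedding_apply (winEmb k i) a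

lemma winPerm_out {k : ℕ} (i : ℕ) (p : Equiv.Perm (Fin k)) (n : ℕ) (hn : n < i ∨ i + k ≤ n) :
    winPerm i p n = n := by
  refine p.viaEmbedding_apply_of_notMem (winEmb k i) n ?_
  rintro ⟨a, ha⟩
  have h1 : i + (a : ℕ) = n := ha
  have := a.isLt
  omega

lemma Pat.p_facts {k : ℕ} {σ τ : Equiv.Perm (Fin k)} (hp : Pat σ τ) (f l z q : Fin k)
    (hf : (f : ℕ) = 1) (hl : (l : ℕ) = k - 1) (hz : (z : ℕ) = 0) (hq : (q : ℕ) = k - 2) :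
    (σ⁻¹ * τ) f = l ∧ (σ⁻¹ * τ) l = f ∧ (σ⁻¹ * τ) z = z ∧ (σ⁻¹ * τ) q = q := by
  simp only [Equiv.Perm.mul_apply, Equiv.Perm.inv_eq_iff_eq]
  refine ⟨(hp.opp2 f l hf hl).symm, (hp.opp1 f l hf hl).symm, ?_, ?_⟩
  · apply Fin.ext; rw [hp.hs.s0 z hz, hp.ht.s0 z hz]
  · apply Fin.ext; rw [hp.hs.s2 q hq, hp.ht.s2 q hq]

lemma Pat.p_occ {k : ℕ} {σ τ : Equiv.Perm (Fin k)} {x y : ℕ → ℝ} {i : ℕ}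
    (hy : ∀ a : Fin k, y (i + a) = x (i + ((σ⁻¹ * τ) a : Fin k))) (ho : OccursAt σ x i) :
    OccursAt τ y i := by
  intro a b
  rw [hy, hy, ho]
  simp

lemma app1 {k : ℕ} {σ τ : Equiv.Perm (Fin k)} (hp : Pat σ τ) {x : ℕ → ℝ} {i : ℕ}
    (hA : FirstAt σ τ i x) (hR : ¬ RCond k i x) :
    FirstAt τ σ i (x ∘ winPerm i (σ⁻¹ * τ)) ∧ ¬ RCond k i (x ∘ winPerm i (σ⁻¹ * τ)) := by
  have hk := hp.hs.hk
  obtain ⟨p1, p2, p3, p4⟩ := hp.p_facts ⟨1, by omega⟩ ⟨k - 1, by omega⟩ ⟨0, by omega⟩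
    ⟨k - 2, by omega⟩ rfl rfl rfl rfl
  have hw : ∀ a : Fin k, (x ∘ winPerm i (σ⁻¹ * τ)) (i + a) = x (i + ((σ⁻¹ * τ) a : Fin k)) :=
    fun a => by rw [Function.comp_apply, winPerm_apply]
  refine step1 hp hA hR (hA.1.comp (Equiv.injective _)) ?_ ?_ ?_ (Pat.p_occ hw hA.2.1)
  · intro n hn
    rcases hn.lt_or_eq with h | rfl
    · rw [Function.comp_apply, winPerm_out _ _ _ (Or.inl h)]
    · have := hw ⟨0, by omega⟩
      rwa [p3] at this
  · have := hw ⟨1, by omega⟩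
    rwa [p1] at this
  · have := hw ⟨k - 1, by omega⟩
    rwa [p2] at this

/-- The rearrangement of the middle of a window. -/
def midPerm {k : ℕ} (hk : 4 ≤ k) (σ τ : Equiv.Perm (Fin k)) : Equiv.Perm (Fin k) :=
  (σ⁻¹ * τ)⁻¹ * Equiv.swap ⟨1, by omega⟩ ⟨k - 1, by omega⟩

lemma app2 {k : ℕ} (hk : 4 ≤ k) {σ τ : Equiv.Perm (Fin k)} (hp : Pat σ τ) {x : ℕ → ℝ} {i : ℕ}
    (hA : FirstAt σ τ i x) (hR : RCond k i x) :
    FirstAt τ σ i (x ∘ (winPerm i (σ⁻¹ * τ) * winPerm (i - (k - 2)) (midPerm hk σ τ) : Equiv.Perm ℕ)) ∧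
      RCond k i (x ∘ (winPerm i (σ⁻¹ * τ) * winPerm (i - (k - 2)) (midPerm hk σ τ) : Equiv.Perm ℕ)) := by
  obtain ⟨j, hj, hH, hb⟩ := hR
  obtain rfl : j = i - (k - 2) := by omega
  set j := i - (k - 2) with hjdef
  obtain ⟨p1, p2, p3, p4⟩ := hp.p_facts ⟨1, by omega⟩ ⟨k - 1, by omega⟩ ⟨0, by omega⟩
    ⟨k - 2, by omega⟩ rfl rfl rfl rfl
  set p := σ⁻¹ * τ with hpdef
  have hpp : ∀ a, σ (p a) = τ a := fun a => by simp [hpdef]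
  -- middle permutation
  have m1 : midPerm hk σ τ ⟨1, by omega⟩ = ⟨1, by omega⟩ := by
    rw [midPerm, ← hpdef, Equiv.Perm.mul_apply, Equiv.swap_apply_left,
      Equiv.Perm.inv_eq_iff_eq, p1]
  have m2 : midPerm hk σ τ ⟨k - 1, by omega⟩ = ⟨k - 1, by omega⟩ := by
    rw [midPerm, ← hpdef, Equiv.Perm.mul_apply, Equiv.swap_apply_right, Equiv.Perm.inv_eq_iff_eq,
      p2]
  have m3 : midPerm hk σ τ ⟨0, by omega⟩ = ⟨0, by omega⟩ := by
    rw [midPerm, ← hpdef, Equiv.Perm.mul_apply, Equiv.swap_apply_of_ne_of_ne,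
      Equiv.Perm.inv_eq_iff_eq, p3] <;> simp [Fin.ext_iff] <;> omega
  have m4 : midPerm hk σ τ ⟨k - 2, by omega⟩ = ⟨k - 2, by omega⟩ := by
    rw [midPerm, ← hpdef, Equiv.Perm.mul_apply, Equiv.swap_apply_of_ne_of_ne,
      Equiv.Perm.inv_eq_iff_eq, p4] <;> simp [Fin.ext_iff] <;> omega
  have m5 : ∀ a : Fin k, 2 ≤ (a : ℕ) → (a : ℕ) + 3 ≤ k → midPerm hk σ τ (p a) = a := by
    intro a ha1 ha2
    have := hp.ht.mid a ha1 ha2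
    rw [← hpp] at this
    have h3 := hp.hs.mid_inv _ this.1 this.2
    rw [midPerm, ← hpdef, Equiv.Perm.mul_apply, Equiv.swap_apply_of_ne_of_ne,
      Equiv.Perm.inv_eq_iff_eq] <;> rw [Ne, Fin.ext_iff] <;> simp only <;> omega
  set m := midPerm hk σ τ with hmdef
  have hfix : ∀ n, i ≤ n → winPerm j m n = n := by
    intro n hn
    by_cases hn2 : j + k ≤ n
    · exact winPerm_out _ _ _ (Or.inr hn2)
    · rcases hn.eq_or_lt with h | h
      · have := winPerm_apply j m ⟨k - 2, by omega⟩
        rw [m4] at this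
        simp only at this
        rw [← h, ← hj]
        exact this
      · have := winPerm_apply j m ⟨k - 1, by omega⟩
        rw [m2] at this
        simp only at this
        have e : n = j + (k - 1) := by omega
        rw [e]
        exact this
  have hw : ∀ a : Fin k, (x ∘ (winPerm i p * winPerm j m : Equiv.Perm ℕ)) (i + a) = x (i + (p a : Fin k)) :=
    fun a => by
      rw [Function.comp_apply, Equiv.Perm.mul_apply, hfix _ (by omega), winPerm_apply]
  refine step2 hp hpp hj hA hH hb (hA.1.comp (Equiv.injective _)) ?_ ?_ ?_ ?_ ?_
    (Pat.p_occ hw hA.2.1)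
  · intro n hn
    have e : winPerm j m n = n := by
      by_cases h1 : n < j
      · exact winPerm_out _ _ _ (Or.inl h1)
      by_cases h2 : n = j
      · have := winPerm_apply j m ⟨0, by omega⟩
        rw [m3] at this
        simpa [h2] using this
      · have h3 : n = j + 1 := by omega
        have := winPerm_apply j m ⟨1, by omega⟩
        rw [m1] at this
        simpa [h3] using this
    rw [Function.comp_apply, Equiv.Perm.mul_apply, e, winPerm_out _ _ _ (Or.inl (by omega))]
  · intro a ha1 ha2
    rw [Function.comp_apply, Equiv.Perm.mul_apply, winPerm_apply, m5 a ha1 ha2,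
      winPerm_out _ _ _ (Or.inl (by omega))]
  · have := hw ⟨0, by omega⟩
    rwa [p3] at this
  · have := hw ⟨1, by omega⟩
    rwa [p1] at this
  · have := hw ⟨k - 1, by omega⟩
    rwa [p2] at this

lemma meas_lt (a b : ℕ) : MeasurableSet {x : ℕ → ℝ | x a < x b} :=
  measurableSet_lt (measurable_pi_apply a) (measurable_pi_apply b)

lemma meas_occ {k : ℕ} (σ : Equiv.Perm (Fin k)) (i : ℕ) : MeasurableSet {x | OccursAt σ x i} := by
  have : {x | OccursAt σ x i} =
      ⋂ a : Fin k, ⋂ b : Fin k, {x : ℕ → ℝ | x (i + a) < x (i + b) ↔ σ a < σ b} := by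
    ext x; simp [OccursAt]
  rw [this]
  refine MeasurableSet.iInter fun a => MeasurableSet.iInter fun b => ?_
  exact (meas_lt _ _).iff (MeasurableSet.const _)

lemma meas_inj : MeasurableSet {x : ℕ → ℝ | Function.Injective x} := by
  have : {x : ℕ → ℝ | Function.Injective x} = ⋂ a : ℕ, ⋂ b : ℕ, {x : ℕ → ℝ | x a = x b → a = b} := by
    ext x; simp [Function.Injective]
  rw [this]
  refine MeasurableSet.iInter fun a => MeasurableSet.iInter fun b => ?_
  exact (measurableSet_eq_fun (measurable_pi_apply a) (measurable_pi_apply b)).imp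
    (MeasurableSet.const _)

lemma meas_first {k : ℕ} (σ τ : Equiv.Perm (Fin k)) (i : ℕ) :
    MeasurableSet {x | FirstAt σ τ i x} := by
  have : {x | FirstAt σ τ i x} = {x : ℕ → ℝ | Function.Injective x} ∩ ({x | OccursAt σ x i} ∩
      ⋂ j : ℕ, ⋂ _ : j < i, ({x | OccursAt σ x j}ᶜ ∩ {x | OccursAt τ x j}ᶜ)) := by
    ext x; simp [FirstAt]
  rw [this]
  refine meas_inj.inter ((meas_occ σ i).inter ?_)
  exact MeasurableSet.iInter fun j => MeasurableSet.iInter fun _ =>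
    (meas_occ σ j).compl.inter (meas_occ τ j).compl

lemma meas_R (k i : ℕ) : MeasurableSet {x | RCond k i x} := by
  have : {x | RCond k i x} = ⋃ j : ℕ, ⋃ _ : j + (k - 2) = i,
      (({x : ℕ → ℝ | x j < x (j + (k - 2))} ∩ ({x : ℕ → ℝ | x (j + (k - 2)) < x (j + 1)} ∩
      ({x : ℕ → ℝ | x (j + (k - 2)) < x (j + (k - 1))} ∩
      ⋂ c : ℕ, ⋂ _ : 2 ≤ c, ⋂ _ : c + 3 ≤ k,
        ({x : ℕ → ℝ | x j < x (j + c)} ∩ {x : ℕ → ℝ | x (j + c) < x (j + (k - 2))})))) ∩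
      {x : ℕ → ℝ | x (j + 1) < x (i + 1) ↔ ¬ x (j + 1) < x (i + (k - 1))}) := by
    ext x
    simp only [RCond, HWin, Set.mem_ofPred_eq, Set.mem_iUnion, Set.mem_inter_iff, Set.mem_iInter,
      exists_prop]
  rw [this]
  refine MeasurableSet.iUnion fun j => MeasurableSet.iUnion fun _ => ?_
  refine MeasurableSet.inter ?_ ((meas_lt _ _).iff (meas_lt _ _).compl)
  refine (meas_lt _ _).inter ((meas_lt _ _).inter ((meas_lt _ _).inter ?_))
  exact MeasurableSet.iInter fun c => MeasurableSet.iInter fun _ => MeasurableSet.iInter fun _ =>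
    (meas_lt _ _).inter (meas_lt _ _)

lemma first_le {μ : Measure (ℕ → ℝ)} (hμ : IsIIDUniform μ) {k : ℕ} {σ τ : Equiv.Perm (Fin k)}
    (hp : Pat σ τ) (i : ℕ) : μ {x | FirstAt σ τ i x} ≤ μ {x | FirstAt τ σ i x} := by
  rw [← measure_inter_add_sdiff {x | FirstAt σ τ i x} (meas_R k i),
    ← measure_inter_add_sdiff {x | FirstAt τ σ i x} (meas_R k i)]
  refine add_le_add ?_ ?_
  · rw [← (iid_perm hμ (winPerm i (σ⁻¹ * τ) * winPerm (i - (k - 2))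
      (midPerm hp.hs.hk σ τ))).measure_preimage
      ((meas_first τ σ i).inter (meas_R k i)).nullMeasurableSet]
    exact measure_mono fun x hx => app2 hp.hs.hk hp hx.1 hx.2
  · rw [← (iid_perm hμ (winPerm i (σ⁻¹ * τ))).measure_preimage
      ((meas_first τ σ i).diff (meas_R k i)).nullMeasurableSet]
    exact measure_mono fun x hx => app1 hp hx.1 hx.2

lemma Pat.not_both {k : ℕ} {σ τ : Equiv.Perm (Fin k)} (hp : Pat σ τ) {x : ℕ → ℝ} {i : ℕ}
    (h1 : OccursAt σ x i) (h2 : OccursAt τ x i) : False := by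
  have hk := hp.hs.hk
  have hs := hp.sign ⟨1, by omega⟩ ⟨k - 1, by omega⟩ rfl rfl
  have a1 := h1 ⟨1, by omega⟩ ⟨k - 1, by omega⟩
  have a2 := h2 ⟨1, by omega⟩ ⟨k - 1, by omega⟩
  tauto

lemma FirstAt.unique {k : ℕ} {σ τ : Equiv.Perm (Fin k)} {x : ℕ → ℝ} {i j : ℕ}
    (h1 : FirstAt σ τ i x) (h2 : FirstAt σ τ j x) : i = j := by
  rcases lt_trichotomy i j with h | h | h
  · exact absurd h1.2.1 (h2.2.2 i h).1
  · exact h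
  · exact absurd h2.2.1 (h1.2.2 j h).1

lemma union_le {μ : Measure (ℕ → ℝ)} (hμ : IsIIDUniform μ) {k : ℕ} {σ τ : Equiv.Perm (Fin k)}
    (hp : Pat σ τ) : μ (⋃ i, {x | FirstAt σ τ i x}) ≤ μ (⋃ i, {x | FirstAt τ σ i x}) := by
  have hd : ∀ σ τ : Equiv.Perm (Fin k),
      Pairwise (Function.onFun Disjoint fun i => {x | FirstAt σ τ i x}) := by
    intro σ τ i j hij
    rw [Function.onFun, Set.disjoint_left]
    exact fun x h1 h2 => hij (FirstAt.unique h1 h2)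
  rw [measure_iUnion (hd σ τ) fun i => meas_first σ τ i,
    measure_iUnion (hd τ σ) fun i => meas_first τ σ i]
  exact ENNReal.tsum_le_tsum fun i => first_le hμ hp i

lemma hit_spec {k : ℕ} {σ : Equiv.Perm (Fin k)} {x : ℕ → ℝ} (h : ∃ i, OccursAt σ x i) :
    ∃ i, hitTime σ x = i + k ∧ OccursAt σ x i ∧ ∀ j < i, ¬ OccursAt σ x j := by
  obtain ⟨i, hi⟩ := h
  have hne : {j | k ≤ j ∧ OccursAt σ x (j - k)}.Nonempty := ⟨i + k, by simp, by simpa using hi⟩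
  have hmem := Nat.sInf_mem hne
  refine ⟨hitTime σ x - k, ?_, hmem.2, ?_⟩
  · have : k ≤ hitTime σ x := hmem.1
    omega
  · intro j hj hoj
    have : hitTime σ x ≤ j + k := Nat.sInf_le ⟨by simp, by simpa using hoj⟩
    omega

theorem tie_1k_alpha_family (μ : Measure (ℕ → ℝ)) (hμ : IsIIDUniform μ)
    (k : ℕ) (hk : 4 ≤ k) (σ τ : Equiv.Perm (Fin k))
    (hσ1 : (σ ⟨0, by omega⟩ : ℕ) = 0) (hτ1 : (τ ⟨0, by omega⟩ : ℕ) = 0)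
    (hσ2 : (σ ⟨1, by omega⟩ : ℕ) = k - 1) (hτ2 : (τ ⟨1, by omega⟩ : ℕ) = k - 2)
    (hσ3 : (σ ⟨k - 2, by omega⟩ : ℕ) = k - 3) (hτ3 : (τ ⟨k - 2, by omega⟩ : ℕ) = k - 3)
    (hσ4 : (σ ⟨k - 1, by omega⟩ : ℕ) = k - 2) (hτ4 : (τ ⟨k - 1, by omega⟩ : ℕ) = k - 1) :
    μ {x | hitTime σ x < hitTime τ x} = 1 / 2 := by
  have hp : Pat σ τ := by
    have ext : ∀ (a : Fin k) (n : ℕ) (hn : n < k), (a : ℕ) = n → a = ⟨n, hn⟩ :=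
      fun a n hn h => Fin.ext h
    refine ⟨⟨hk, ?_, ?_, ?_, ?_⟩, ⟨hk, ?_, ?_, ?_, ?_⟩, ?_, ?_⟩
    · intro a ha; rw [ext a _ _ ha]; exact hσ1
    · intro a ha; rw [ext a _ _ ha]; exact hσ3
    · intro a ha; rw [ext a _ (by omega) ha, hσ2]; omega
    · intro a ha; rw [ext a _ (by omega) ha, hσ4]
    · intro a ha; rw [ext a _ _ ha]; exact hτ1
    · intro a ha; rw [ext a _ _ ha]; exact hτ3
    · intro a ha; rw [ext a _ (by omega) ha, hτ2]
    · intro a ha; rw [ext a _ (by omega) ha, hτ4]; omega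
    · intro f l hf hl
      rw [ext f _ (by omega) hf, ext l _ (by omega) hl]
      exact Fin.ext (by rw [hσ2, hτ4])
    · intro f l hf hl
      rw [ext f _ (by omega) hf, ext l _ (by omega) hl]
      exact Fin.ext (by rw [hσ4, hτ2])
  have hprob := hμ.1
  have hi := iid_inj hμ
  have ho1 := occurs_ae hμ (by omega : 0 < k) σ
  have ho2 := occurs_ae hμ (by omega : 0 < k) τ
  set U := ⋃ i, {x | FirstAt σ τ i x} with hU
  set V := ⋃ i, {x | FirstAt τ σ i x} with hV
  have hVm : MeasurableSet V := MeasurableSet.iUnion fun i => meas_first τ σ i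
  have hUV : μ U = μ V := le_antisymm (union_le hμ hp) (union_le hμ hp.symm)
  have hae : ∀ᵐ x ∂μ, ((hitTime σ x < hitTime τ x) ↔ x ∈ U) ∧ (x ∈ U ↔ x ∉ V) := by
    filter_upwards [hi, ho1, ho2] with x hx h1 h2
    obtain ⟨a, ha1, ha2, ha3⟩ := hit_spec h1
    obtain ⟨b, hb1, hb2, hb3⟩ := hit_spec h2
    have hUi : x ∈ U ↔ a < b := by
      simp only [hU, Set.mem_iUnion, Set.mem_ofPred_eq]
      constructor
      · rintro ⟨i, _, hi2, hi3⟩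
        have h3 : i ≤ b := by
          by_contra hlt
          exact (hi3 b (by omega)).2 hb2
        have h4 : a ≤ i := by
          by_contra hlt
          exact ha3 i (by omega) hi2
        have h5 : i ≠ b := fun h => hp.not_both hi2 (h ▸ hb2)
        omega
      · intro hab
        exact ⟨a, hx, ha2, fun j hj => ⟨ha3 j hj, hb3 j (by omega)⟩⟩
    have hVi : x ∈ V ↔ b < a := by
      simp only [hV, Set.mem_iUnion, Set.mem_ofPred_eq]
      constructor
      · rintro ⟨i, _, hi2, hi3⟩
        have h3 : i ≤ a := by
          by_contra hlt
          exact (hi3 a (by omega)).2 ha2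
        have h4 : b ≤ i := by
          by_contra hlt
          exact hb3 i (by omega) hi2
        have h5 : i ≠ a := fun h => hp.not_both (h ▸ ha2) hi2
        omega
      · intro hab
        exact ⟨b, hx, hb2, fun j hj => ⟨hb3 j hj, ha3 j (by omega)⟩⟩
    have hne : a ≠ b := fun h => hp.not_both ha2 (h ▸ hb2)
    rw [hUi, hVi, ha1, hb1]
    omega
  have e1 : μ {x | hitTime σ x < hitTime τ x} = μ U :=
    measure_congr (by filter_upwards [hae] with x hx using propext hx.1)
  have e2 : μ U = μ Vᶜ :=
    measure_congr (by filter_upwards [hae] with x hx using propext hx.2)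
  have e3 : μ V + μ Vᶜ = 1 := prob_add_prob_compl hVm
  rw [← e2, ← hUV] at e3
  rw [e1, ENNReal.eq_div_iff (by simp) (by simp), two_mul]
  exact e3

end
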